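/- arXiv:0712.0248 — 6 statements merged into one kernel-verified Lean document; each statement's English description precedes it below -/
import Mathlib

section
/- Define D(θ,θ') = N^{-1} ∑_{i=1}^N P[ f_θ(X_i) ≠ f_{θ'}(X_i) ]. Fix a probability measure π on Θ and assume: (a) there exist θ̃ ∈ Θ, a real constant c > 0 and a real exponent κ ≥ 1 such that R(θ) ≥ R(θ̃) + c · D(θ,θ̃)^κ for every θ ∈ Θ (so that R(θ̃) = inf_Θ R); (b) there is a real constant d > 0 such that π_{exp(−γR)}(R) − inf_Θ R ≤ d/γ for every γ > 0. Let λ̄ = 2^{-1} (8 log 2 · d)^{(κ−1)/(2κ−1)} (κ c)^{1/(2κ−1)} N^{κ/(2κ−1)}. Then P[ π_{exp(−λ̄ r(·,ω))}( R ) ] ≤ inf_Θ R + (2 − κ^{-1}) (κ c)^{−1/(2κ−1)} ( 8 log 2 · d / N )^{κ/(2κ−1)}. -/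
open MeasureTheory ProbabilityTheory

/-- `Φ_a(p) = -a⁻¹ log(1 - (1 - e^{-a}) p)` for `a ≠ 0`, and `Φ_0(p) = p`. -/
noncomputable def Phi (a p : ℝ) : ℝ :=
  if a = 0 then p else -a⁻¹ * Real.log (1 - (1 - Real.exp (-a)) * p)

/-- `Φ_a⁻¹(q) = (1 - e^{-aq})/(1 - e^{-a})` for `a ≠ 0`, and `Φ_0⁻¹(q) = q`. -/
noncomputable def PhiInv (a q : ℝ) : ℝ :=
  if a = 0 then q else (1 - Real.exp (-(a * q))) / (1 - Real.exp (-a))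

/-- Kullback–Leibler divergence `K(ρ,π) = ∫ log (dρ/dπ) dρ` (as a real number;
meaningful under `KLFin ρ π`). -/
noncomputable def KL {Θ : Type*} [MeasurableSpace Θ] (ρ π : Measure Θ) : ℝ :=
  ∫ θ, Real.log ((ρ.rnDeriv π θ).toReal) ∂ρ

/-- Finiteness of the Kullback–Leibler divergence: `ρ ≪ π` and `log (dρ/dπ)`
is `ρ`-integrable. -/
def KLFin {Θ : Type*} [MeasurableSpace Θ] (ρ π : Measure Θ) : Prop :=
  ρ ≪ π ∧ Integrable (fun θ => Real.log ((ρ.rnDeriv π θ).toReal)) ρ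

/-- The Gibbs measure `π_{exp h}` with density `exp h / π[exp h]` with respect to `π`. -/
noncomputable def Gibbs {Θ : Type*} [MeasurableSpace Θ] (π : Measure Θ) (h : Θ → ℝ) :
    Measure Θ :=
  (ENNReal.ofReal (∫ θ, Real.exp (h θ) ∂π))⁻¹ •
    π.withDensity (fun θ => ENNReal.ofReal (Real.exp (h θ)))

/-- Empirical error rate `r(θ,ω) = N⁻¹ ∑ᵢ 1[f_θ(X_i) ≠ Y_i]`. -/
noncomputable def empErr {𝒳 𝒴 Θ : Type*} [DecidableEq 𝒴] (N : ℕ)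
    (f : Θ → 𝒳 → 𝒴) (θ : Θ) (ω : Fin N → 𝒳 × 𝒴) : ℝ :=
  (N : ℝ)⁻¹ * ∑ i, if f θ (ω i).1 = (ω i).2 then 0 else 1

/-- Expected error rate `R(θ) = N⁻¹ ∑ᵢ P[f_θ(X_i) ≠ Y_i]`. -/
noncomputable def expErr {𝒳 𝒴 Θ : Type*} [MeasurableSpace 𝒳] [MeasurableSpace 𝒴] (N : ℕ)
    (P : Measure (Fin N → 𝒳 × 𝒴)) (f : Θ → 𝒳 → 𝒴) (θ : Θ) : ℝ :=
  (N : ℝ)⁻¹ * ∑ i, (P {ω | f θ (ω i).1 ≠ (ω i).2}).toReal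

/-- Pseudo-distance `D(θ,θ') = N⁻¹ ∑ᵢ P[f_θ(X_i) ≠ f_{θ'}(X_i)]`. -/
noncomputable def patDist {𝒳 𝒴 Θ : Type*} [MeasurableSpace 𝒳] [MeasurableSpace 𝒴] (N : ℕ)
    (P : Measure (Fin N → 𝒳 × 𝒴)) (f : Θ → 𝒳 → 𝒴) (θ θ' : Θ) : ℝ :=
  (N : ℝ)⁻¹ * ∑ i, (P {ω | f θ (ω i).1 ≠ f θ' (ω i).1}).toReal

theorem sinh_le_mul_cosh {x : ℝ} (hx : 0 ≤ x) : Real.sinh x ≤ x * Real.cosh x := by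
  have hmono : MonotoneOn (fun y : ℝ => y * Real.cosh y - Real.sinh y) (Set.Ici 0) := by
    refine monotoneOn_of_hasDerivWithinAt_nonneg (f' := fun y => y * Real.sinh y)
      (convex_Ici 0) (by fun_prop) (fun y _ => ?_) (fun y hy => ?_)
    · have h := ((hasDerivAt_id' y).mul (Real.hasDerivAt_cosh y)).sub (Real.hasDerivAt_sinh y)
      refine (h.congr_deriv ?_).hasDerivWithinAt
      ring
    · rw [interior_Ici] at hy
      exact mul_nonneg (le_of_lt hy) (Real.sinh_nonneg_iff.2 (le_of_lt hy))
  have h := hmono Set.self_mem_Ici hx hx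
  simp only [Real.sinh_zero] at h
  linarith

theorem cosh_sub_one_le {a : ℝ} (ha : 0 ≤ a) :
    Real.cosh a - 1 ≤ a / 2 * Real.sinh a := by
  have h1 := Real.cosh_two_mul (a / 2)
  have h2 := Real.sinh_two_mul (a / 2)
  have h3 := Real.cosh_sq (a / 2)
  rw [mul_div_cancel₀ a two_ne_zero] at h1 h2
  have h4 := sinh_le_mul_cosh (show 0 ≤ a / 2 by positivity)
  have h5 : 0 ≤ Real.sinh (a / 2) := Real.sinh_nonneg_iff.2 (by positivity)
  rw [h1, h2, h3]
  nlinarith [mul_le_mul_of_nonneg_left h4 h5]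

theorem integrable_of_measurable_of_abs_le {α : Type*} [MeasurableSpace α] {μ : Measure α}
    [IsFiniteMeasure μ] {g : α → ℝ} {C : ℝ} (hg : Measurable g) (hC : ∀ x, |g x| ≤ C) :
    Integrable g μ :=
  .of_bound hg.aestronglyMeasurable C (.of_forall hC)

theorem integral_le_log_integral_exp {α : Type*} [MeasurableSpace α] {μ : Measure α}
    [IsProbabilityMeasure μ] {g : α → ℝ} (hg : Integrable g μ)
    (hexp : Integrable (fun x => Real.exp (g x)) μ) :
    ∫ x, g x ∂μ ≤ Real.log (∫ x, Real.exp (g x) ∂μ) := by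
  rw [Real.le_log_iff_exp_le (integral_exp_pos hexp)]
  exact convexOn_exp.map_integral_le Real.continuous_exp.continuousOn isClosed_univ
    (by simp) hg hexp

theorem integrable_exp_of_abs_le {α : Type*} [MeasurableSpace α] {μ : Measure α}
    [IsFiniteMeasure μ] {g : α → ℝ} {C : ℝ} (hg : Measurable g) (hC : ∀ x, |g x| ≤ C) :
    Integrable (fun x => Real.exp (g x)) μ :=
  integrable_of_measurable_of_abs_le (C := Real.exp C) hg.exp fun x => by
    rw [Real.abs_exp]
    exact Real.exp_le_exp.2 ((le_abs_self _).trans (hC x))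

theorem abs_integral_le_of_abs_le {α : Type*} [MeasurableSpace α] {μ : Measure α}
    [IsProbabilityMeasure μ] {g : α → ℝ} {C : ℝ} (hC : ∀ x, |g x| ≤ C) :
    |∫ x, g x ∂μ| ≤ C := by
  have h := norm_integral_le_of_norm_le_const (μ := μ) (f := g) (.of_forall hC)
  rw [probReal_univ, mul_one] at h
  exact h

theorem abs_log_integral_exp_le {α : Type*} [MeasurableSpace α] {μ : Measure α}
    [IsProbabilityMeasure μ] {g : α → ℝ} {C : ℝ} (hg : Measurable g) (hC : ∀ x, |g x| ≤ C) :
    |Real.log (∫ x, Real.exp (g x) ∂μ)| ≤ C := by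
  have hint := integrable_of_measurable_of_abs_le (μ := μ) hg hC
  have hexp := integrable_exp_of_abs_le (μ := μ) hg hC
  rw [abs_le]
  constructor
  · exact (abs_le.1 (abs_integral_le_of_abs_le hC)).1.trans
      (integral_le_log_integral_exp hint hexp)
  · rw [Real.log_le_iff_le_exp (integral_exp_pos hexp)]
    calc ∫ x, Real.exp (g x) ∂μ ≤ ∫ _, Real.exp C ∂μ :=
          integral_mono hexp (integrable_const _)
            fun x => Real.exp_le_exp.2 ((le_abs_self _).trans (hC x))
      _ = Real.exp C := by simp

theorem integral_log_integral_exp_le {Θ Ω : Type*} [MeasurableSpace Θ] [MeasurableSpace Ω]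
    (μ : Measure Θ) [IsProbabilityMeasure μ] (P : Measure Ω) [IsProbabilityMeasure P]
    {u : Θ → Ω → ℝ} {C : ℝ} (hu : Measurable (Function.uncurry u))
    (hC : ∀ θ ω, |u θ ω| ≤ C) :
    ∫ ω, Real.log (∫ θ, Real.exp (u θ ω) ∂μ) ∂P
      ≤ Real.log (∫ θ, ∫ ω, Real.exp (u θ ω) ∂P ∂μ) := by
  have hZm : Measurable fun ω => ∫ θ, Real.exp (u θ ω) ∂μ :=
    (StronglyMeasurable.integral_prod_left
      (f := fun θ ω => Real.exp (u θ ω)) hu.exp.stronglyMeasurable).measurable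
  have hZ : ∀ ω, Real.exp (Real.log (∫ θ, Real.exp (u θ ω) ∂μ)) = ∫ θ, Real.exp (u θ ω) ∂μ :=
    fun ω => Real.exp_log (integral_exp_pos
      (integrable_exp_of_abs_le (hu.comp measurable_prodMk_right) (hC · ω)))
  have habs := fun ω =>
    abs_log_integral_exp_le (μ := μ) (hu.comp measurable_prodMk_right) (hC · ω)
  refine (integral_le_log_integral_exp (integrable_of_measurable_of_abs_le hZm.log habs)
    (integrable_exp_of_abs_le hZm.log habs)).trans_eq ?_
  simp_rw [hZ]
  have hint : Integrable (Function.uncurry fun θ ω => Real.exp (u θ ω)) (μ.prod P) :=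
    integrable_exp_of_abs_le hu fun p => hC p.1 p.2
  exact congrArg Real.log (integral_integral_swap hint).symm

theorem log_integral_exp_integral_le {Θ Ω : Type*} [MeasurableSpace Θ] [MeasurableSpace Ω]
    (μ : Measure Θ) [IsProbabilityMeasure μ] (P : Measure Ω) [IsProbabilityMeasure P]
    {u : Θ → Ω → ℝ} {C : ℝ} (hu : Measurable (Function.uncurry u))
    (hC : ∀ θ ω, |u θ ω| ≤ C) :
    Real.log (∫ θ, Real.exp (∫ ω, u θ ω ∂P) ∂μ)
      ≤ ∫ ω, Real.log (∫ θ, Real.exp (u θ ω) ∂μ) ∂P := by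
  have hZm : Measurable fun ω => ∫ θ, Real.exp (u θ ω) ∂μ :=
    (StronglyMeasurable.integral_prod_left
      (f := fun θ ω => Real.exp (u θ ω)) hu.exp.stronglyMeasurable).measurable
  set v : Θ → ℝ := fun θ => ∫ ω, u θ ω ∂P
  have hv : Measurable v := (StronglyMeasurable.integral_prod_right
      (f := u) hu.stronglyMeasurable).measurable
  have hvC : ∀ θ, |v θ| ≤ C := fun θ => abs_integral_le_of_abs_le (hC θ)
  have hvexp := integrable_exp_of_abs_le (μ := μ) hv hvC
  set ν := μ.tilted v
  have : IsProbabilityMeasure ν := isProbabilityMeasure_tilted hvexp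
  have hw : Measurable (Function.uncurry fun θ ω => u θ ω - v θ) :=
    hu.sub (hv.comp measurable_fst)
  have hwC : ∀ θ ω, |u θ ω - v θ| ≤ C + C := fun θ ω =>
    (abs_sub _ _).trans (add_le_add (hC θ ω) (hvC θ))
  have hpoint : ∀ ω, ∫ θ, (u θ ω - v θ) ∂ν ≤
      Real.log (∫ θ, Real.exp (u θ ω) ∂μ) - Real.log (∫ θ, Real.exp (v θ) ∂μ) := by
    intro ω
    have hm : Measurable fun θ => u θ ω - v θ := hw.comp measurable_prodMk_right
    refine (integral_le_log_integral_exp (integrable_of_measurable_of_abs_le hm (hwC · ω))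
      (integrable_exp_of_abs_le hm (hwC · ω))).trans_eq ?_
    rw [integral_exp_tilted, Real.log_div]
    · simp
    · simpa using (integral_exp_pos (integrable_exp_of_abs_le (μ := μ)
        (hu.comp measurable_prodMk_right) (hC · ω))).ne'
    · exact (integral_exp_pos hvexp).ne'
  have hlog : Integrable (fun ω => Real.log (∫ θ, Real.exp (u θ ω) ∂μ)) P :=
    integrable_of_measurable_of_abs_le hZm.log fun ω =>
      abs_log_integral_exp_le (hu.comp measurable_prodMk_right) (hC · ω)
  have hwint : Integrable (Function.uncurry fun θ ω => u θ ω - v θ) (ν.prod P) :=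
    integrable_of_measurable_of_abs_le hw fun p => hwC p.1 p.2
  have h := integral_mono hwint.integral_prod_right (hlog.sub (integrable_const _)) hpoint
  have hzero : ∫ ω, ∫ θ, (u θ ω - v θ) ∂ν ∂P = 0 := by
    rw [← integral_integral_swap hwint]
    have : ∀ θ, ∫ ω, (u θ ω - v θ) ∂P = 0 := fun θ => by
      have huθ : Integrable (u θ) P :=
        integrable_of_measurable_of_abs_le (hu.comp measurable_prodMk_left) (hC θ)
      rw [integral_sub huθ (integrable_const _)]
      simp [v]
    simp [this]
  have hsub : ∫ ω, (Real.log (∫ θ, Real.exp (u θ ω) ∂μ)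
      - Real.log (∫ θ, Real.exp (v θ) ∂μ)) ∂P
      = ∫ ω, Real.log (∫ θ, Real.exp (u θ ω) ∂μ) ∂P
        - Real.log (∫ θ, Real.exp (v θ) ∂μ) := by
    rw [integral_sub hlog (integrable_const _)]
    simp
  have h' := hzero.symm.le.trans (h.trans_eq hsub)
  linarith

theorem integrable_integral_tilted {Θ Ω : Type*} [MeasurableSpace Θ] [MeasurableSpace Ω]
    (μ : Measure Θ) [IsProbabilityMeasure μ] (P : Measure Ω) [IsProbabilityMeasure P]
    {u : Θ → Ω → ℝ} {h : Θ → ℝ} {C B : ℝ} (hu : Measurable (Function.uncurry u))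
    (hC : ∀ θ ω, |u θ ω| ≤ C) (hh : Measurable h) (hB : ∀ θ, |h θ| ≤ B) :
    Integrable (fun ω => ∫ θ, h θ ∂(μ.tilted fun θ => u θ ω)) P := by
  have hmeas : Measurable fun ω => ∫ θ, h θ ∂(μ.tilted fun θ => u θ ω) := by
    simp_rw [integral_tilted, smul_eq_mul]
    refine (StronglyMeasurable.integral_prod_left
      (f := fun θ ω => Real.exp (u θ ω) / (∫ x, Real.exp (u x ω) ∂μ) * h θ)
      (Measurable.stronglyMeasurable ?_)).measurable
    refine (hu.exp.div ?_).mul (hh.comp measurable_fst)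
    exact (StronglyMeasurable.integral_prod_left
      (f := fun θ ω => Real.exp (u θ ω)) hu.exp.stronglyMeasurable).measurable.comp measurable_snd
  refine integrable_of_measurable_of_abs_le (C := B) hmeas fun ω => ?_
  have : IsProbabilityMeasure (μ.tilted fun θ => u θ ω) := isProbabilityMeasure_tilted
    (integrable_exp_of_abs_le (hu.comp measurable_prodMk_right) (hC · ω))
  exact abs_integral_le_of_abs_le hB

theorem integral_integral_tilted_le {Θ Ω : Type*} [MeasurableSpace Θ] [MeasurableSpace Ω]
    (μ : Measure Θ) [IsProbabilityMeasure μ] (P : Measure Ω) [IsProbabilityMeasure P]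
    {u : Θ → Ω → ℝ} {h : Θ → ℝ} {C B : ℝ} (hu : Measurable (Function.uncurry u))
    (hC : ∀ θ ω, |u θ ω| ≤ C) (hh : Measurable h) (hB : ∀ θ, |h θ| ≤ B) :
    ∫ ω, ∫ θ, h θ ∂(μ.tilted fun θ => u θ ω) ∂P
      ≤ Real.log (∫ θ, ∫ ω, Real.exp (u θ ω + h θ) ∂P ∂μ)
        - Real.log (∫ θ, Real.exp (∫ ω, u θ ω ∂P) ∂μ) := by
  have hw : Measurable (Function.uncurry fun θ ω => u θ ω + h θ) :=
    hu.add (hh.comp measurable_fst)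
  have hwC : ∀ θ ω, |u θ ω + h θ| ≤ C + B := fun θ ω =>
    (abs_add_le _ _).trans (add_le_add (hC θ ω) (hB θ))
  have hlogm : ∀ {g : Θ → Ω → ℝ} {K : ℝ}, Measurable (Function.uncurry g) →
      (∀ θ ω, |g θ ω| ≤ K) → Integrable (fun ω => Real.log (∫ θ, Real.exp (g θ ω) ∂μ)) P :=
    fun {g} _ hg hK => integrable_of_measurable_of_abs_le (StronglyMeasurable.integral_prod_left
      (f := fun θ ω => Real.exp (g θ ω)) hg.exp.stronglyMeasurable).measurable.log
      fun ω => abs_log_integral_exp_le (hg.comp measurable_prodMk_right) (hK · ω)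
  have huexp : ∀ ω, Integrable (fun θ => Real.exp (u θ ω)) μ := fun ω =>
    integrable_exp_of_abs_le (hu.comp measurable_prodMk_right) (hC · ω)
  have hpoint : ∀ ω, ∫ θ, h θ ∂(μ.tilted fun θ => u θ ω) ≤
      Real.log (∫ θ, Real.exp (u θ ω + h θ) ∂μ) - Real.log (∫ θ, Real.exp (u θ ω) ∂μ) := by
    intro ω
    have : IsProbabilityMeasure (μ.tilted fun θ => u θ ω) :=
      isProbabilityMeasure_tilted (huexp ω)
    refine (integral_le_log_integral_exp (integrable_of_measurable_of_abs_le hh hB)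
      (integrable_exp_of_abs_le hh hB)).trans_eq ?_
    rw [integral_exp_tilted, Real.log_div]
    · simp
    · simpa using (integral_exp_pos (integrable_exp_of_abs_le (μ := μ)
        (hw.comp measurable_prodMk_right) (hwC · ω))).ne'
    · exact (integral_exp_pos (huexp ω)).ne'
  have hint := integrable_integral_tilted μ P hu hC hh hB
  refine (integral_mono hint ((hlogm hw hwC).sub (hlogm hu hC)) hpoint).trans ?_
  simp only [Pi.sub_apply]
  rw [integral_sub (hlogm hw hwC) (hlogm hu hC)]
  exact sub_le_sub (integral_log_integral_exp_le μ P hw hwC)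
    (log_integral_exp_integral_le μ P hu hC)

theorem gibbs_eq_tilted {Θ : Type*} [MeasurableSpace Θ] (μ : Measure Θ) [NeZero μ]
    {g : Θ → ℝ} (hg : Measurable g) (hexp : Integrable (fun θ => Real.exp (g θ)) μ) :
    Gibbs μ g = μ.tilted g := by
  rw [Gibbs, Measure.tilted, ← withDensity_smul _ (by fun_prop)]
  congr 1
  ext θ
  rw [Pi.smul_apply, smul_eq_mul, ENNReal.ofReal_div_of_pos (integral_exp_pos hexp), mul_comm,
    div_eq_mul_inv]

theorem tilted_add_const {Θ : Type*} [MeasurableSpace Θ] (μ : Measure Θ) (g : Θ → ℝ) (b : ℝ) :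
    μ.tilted (fun θ => g θ + b) = μ.tilted g := by
  simp only [Measure.tilted, Real.exp_add, integral_mul_const,
    mul_div_mul_right _ _ (Real.exp_ne_zero b)]

theorem log_integral_exp_sub_le {Θ : Type*} [MeasurableSpace Θ] (μ : Measure Θ)
    [IsProbabilityMeasure μ] {g : Θ → ℝ} {C d : ℝ} (hg : Measurable g) (hC : ∀ θ, |g θ| ≤ C)
    (hdim : ∀ γ : ℝ, 0 < γ → ∫ θ, g θ ∂(μ.tilted fun θ => -(γ * g θ)) ≤ d / γ)
    {a b : ℝ} (ha : 0 < a) (hab : a ≤ b) :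
    Real.log (∫ θ, Real.exp (-(a * g θ)) ∂μ) - Real.log (∫ θ, Real.exp (-(b * g θ)) ∂μ)
      ≤ d * Real.log (b / a) := by
  set X : Θ → ℝ := fun θ => -g θ
  have huniv : integrableExpSet X μ = Set.univ := by
    refine Set.eq_univ_of_forall fun t => ?_
    refine integrable_exp_of_abs_le (C := |t| * C) (hg.neg.const_mul t) fun θ => ?_
    rw [abs_mul, abs_neg]
    exact mul_le_mul_of_nonneg_left (hC θ) (abs_nonneg t)
  have hmem : ∀ t, t ∈ interior (integrableExpSet X μ) := by simp [huniv]
  have hderiv : ∀ t, HasDerivAt (cgf X μ) (-∫ θ, g θ ∂(μ.tilted fun θ => -(t * g θ))) t := by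
    intro t
    refine (analyticAt_cgf (hmem t)).differentiableAt.hasDerivAt.congr_deriv ?_
    symm
    rw [deriv_cgf (hmem t), integral_tilted, mgf, ← integral_neg, ← integral_div]
    congr 1 with θ
    simp only [X, smul_eq_mul, mul_neg]
    ring
  have hmono : MonotoneOn (fun t => cgf X μ t + d * Real.log t) (Set.Ioi 0) := by
    have hd : ∀ t ∈ Set.Ioi (0 : ℝ), HasDerivAt (fun t => cgf X μ t + d * Real.log t)
        (-(∫ θ, g θ ∂(μ.tilted fun θ => -(t * g θ))) + d * t⁻¹) t := fun t ht =>
      (hderiv t).add ((Real.hasDerivAt_log (ne_of_gt ht)).const_mul d)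
    refine monotoneOn_of_hasDerivWithinAt_nonneg (convex_Ioi 0)
      (fun t ht => (hd t ht).continuousAt.continuousWithinAt)
      (fun t ht => (hd t (interior_subset ht)).hasDerivWithinAt) fun t ht => ?_
    have := hdim t (interior_subset ht)
    rw [div_eq_mul_inv] at this
    linarith
  have h := hmono (Set.mem_Ioi.2 ha) (Set.mem_Ioi.2 (ha.trans_le hab)) hab
  simp only [cgf, mgf, X, mul_neg] at h
  rw [Real.log_div (ha.trans_le hab).ne' ha.ne']
  linarith

theorem exp_neg_mul_eq_of_mem {w : ℝ} (hw : w = -1 ∨ w = 0 ∨ w = 1) (a : ℝ) :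
    Real.exp (-(a * w)) = 1 - Real.sinh a * w + (Real.cosh a - 1) * w ^ 2 := by
  rcases hw with rfl | rfl | rfl
  · rw [mul_neg_one, neg_neg, ← Real.cosh_add_sinh]
    ring
  · simp
  · rw [mul_one, ← Real.cosh_sub_sinh]
    ring

theorem integral_exp_neg_sum_le {ι E : Type*} [Fintype ι] [MeasurableSpace E] (Q : ι → Measure E)
    [∀ i, IsProbabilityMeasure (Q i)] {W V : E → ℝ} (hWm : Measurable W) (hVm : Measurable V)
    (hW : ∀ z, W z = -1 ∨ W z = 0 ∨ W z = 1) (hV : ∀ z, |V z| ≤ 1) (hWV : ∀ z, W z ^ 2 ≤ V z)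
    (a : ℝ) :
    ∫ ω, Real.exp (-(a * ∑ i, W (ω i))) ∂(Measure.pi Q)
      ≤ Real.exp (-(Real.sinh a * ∑ i, ∫ z, W z ∂(Q i))
          + (Real.cosh a - 1) * ∑ i, ∫ z, V z ∂(Q i)) := by
  have hWb : ∀ z, |W z| ≤ 1 := fun z => by rcases hW z with h | h | h <;> simp [h]
  simp_rw [Finset.mul_sum, ← Finset.sum_neg_distrib, ← Finset.sum_add_distrib, Real.exp_sum]
  rw [integral_fintype_prod_eq_prod (fun _ z => Real.exp (-(a * W z)))]
  refine Finset.prod_le_prod (fun i _ => integral_nonneg fun z => (Real.exp_pos _).le)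
    fun i _ => ?_
  have hWi : Integrable W (Q i) := integrable_of_measurable_of_abs_le hWm hWb
  have hVi : Integrable V (Q i) := integrable_of_measurable_of_abs_le hVm hV
  have hexp : Integrable (fun z => Real.exp (-(a * W z))) (Q i) :=
    integrable_exp_of_abs_le (C := |a|) (hWm.const_mul a).neg fun z => by
      rw [abs_neg, abs_mul]
      exact mul_le_of_le_one_right (abs_nonneg a) (hWb z)
  have hbound : Integrable (fun z => 1 - Real.sinh a * W z + (Real.cosh a - 1) * V z) (Q i) :=
    ((integrable_const _).sub (hWi.const_mul _)).add (hVi.const_mul _)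
  calc ∫ z, Real.exp (-(a * W z)) ∂(Q i)
      ≤ ∫ z, (1 - Real.sinh a * W z + (Real.cosh a - 1) * V z) ∂(Q i) :=
        integral_mono hexp hbound fun z => by
          simp only [exp_neg_mul_eq_of_mem (hW z) a]
          gcongr
          · linarith [Real.one_le_cosh a]
          · exact hWV z
    _ = -(Real.sinh a * ∫ z, W z ∂(Q i)) + (Real.cosh a - 1) * ∫ z, V z ∂(Q i) + 1 := by
        have hsub : Integrable (fun z => 1 - Real.sinh a * W z) (Q i) :=
          (integrable_const _).sub (hWi.const_mul _)
        rw [integral_add hsub (hVi.const_mul _),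
          integral_sub (integrable_const _) (hWi.const_mul _), integral_const_mul,
          integral_const_mul]
        simp
        ring
    _ ≤ _ := Real.add_one_le_exp _

theorem toReal_pi_setOf_eval {ι E : Type*} [Fintype ι] [MeasurableSpace E] (Q : ι → Measure E)
    [∀ i, IsProbabilityMeasure (Q i)] (i : ι) {p : E → Prop} [DecidablePred p]
    (hp : MeasurableSet {z | p z}) :
    (Measure.pi Q {ω | ¬ p (ω i)}).toReal = ∫ z, (if p z then 0 else 1 : ℝ) ∂(Q i) := by
  have h := (measurePreserving_eval Q i).measure_preimage hp.compl.nullMeasurableSet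
  have h' : (fun z => if p z then 0 else 1 : E → ℝ) = {z | p z}ᶜ.indicator 1 := by
    ext z
    by_cases hz : p z <;> simp [hz]
  rw [h', integral_indicator_one hp.compl, Measure.real, ← h]
  rfl

theorem rate_identities {l k n κ : ℝ} (hl : 0 < l) (hk : 0 < k) (hn : 0 < n) (hκ : 1 ≤ κ) :
    (2⁻¹ * l ^ ((κ - 1) / (2 * κ - 1)) * k ^ (1 / (2 * κ - 1)) * n ^ (κ / (2 * κ - 1)))
        * (k ^ (-(1 / (2 * κ - 1))) * (l / n) ^ (κ / (2 * κ - 1))) = l / 2 ∧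
      k * (k ^ (-(1 / (2 * κ - 1))) * (l / n) ^ (κ / (2 * κ - 1)) * n
          / (2 * (2⁻¹ * l ^ ((κ - 1) / (2 * κ - 1)) * k ^ (1 / (2 * κ - 1))
            * n ^ (κ / (2 * κ - 1))))) ^ κ
        = k ^ (-(1 / (2 * κ - 1))) * (l / n) ^ (κ / (2 * κ - 1)) := by
  have hs : 2 * κ - 1 ≠ 0 := by linarith
  obtain ⟨p, rfl⟩ : ∃ p, Real.exp p = l := ⟨_, Real.exp_log hl⟩
  obtain ⟨q, rfl⟩ : ∃ q, Real.exp q = k := ⟨_, Real.exp_log hk⟩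
  obtain ⟨m, rfl⟩ : ∃ m, Real.exp m = n := ⟨_, Real.exp_log hn⟩
  have hcancel : ∀ x y z : ℝ, 2 * (2⁻¹ * x * y * z) = x * y * z := fun x y z => by ring
  constructor
  · rw [mul_assoc 2⁻¹, mul_assoc 2⁻¹, mul_assoc 2⁻¹, inv_mul_eq_div]
    congr 1
    simp only [← Real.exp_sub, ← Real.exp_mul, ← Real.exp_add]
    congr 1
    linear_combination p * mul_inv_cancel₀ hs
  · rw [hcancel]
    simp only [← Real.exp_sub, ← Real.exp_mul, ← Real.exp_add]
    congr 1
    field_simp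
    ring

theorem mul_le_of_margin {c κ B t D Δ D₀ : ℝ} (hc : 0 < c) (hκ : 1 ≤ κ) (hD : 0 ≤ D)
    (hD₀ : 0 < D₀) (hcD₀ : κ * c * D₀ ^ κ = B) (htD₀ : t * D₀ = B / 2)
    (hmargin : c * D ^ κ ≤ Δ) :
    t * D ≤ Δ / 2 + (1 - κ⁻¹) * B / 2 := by
  have hκ0 : 0 < κ := by linarith
  have hbern := one_add_mul_self_le_rpow_one_add (s := D / D₀ - 1)
    (by linarith [div_nonneg hD hD₀.le]) hκ
  rw [add_sub_cancel, Real.div_rpow hD hD₀.le, le_div_iff₀ (by positivity)] at hbern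
  have h1 := (mul_le_mul_of_nonneg_left hbern hc.le).trans hmargin
  have h2 : c * D₀ ^ κ = κ⁻¹ * B := by
    rw [← hcD₀]
    field_simp
  have h3 : t * D = B / 2 * (D / D₀) := by
    rw [← htD₀]
    field_simp
  have h4 : c * ((1 + κ * (D / D₀ - 1)) * D₀ ^ κ)
      = κ⁻¹ * B + B * (D / D₀ - 1) := by
    rw [← hcD₀]
    field_simp
  rw [h3]
  rw [h4] at h1
  linarith

theorem ite_sub_ite_mem (p q : Prop) [Decidable p] [Decidable q] :
    (if p then 0 else 1 : ℝ) - (if q then 0 else 1) = -1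
      ∨ (if p then 0 else 1 : ℝ) - (if q then 0 else 1) = 0
      ∨ (if p then 0 else 1 : ℝ) - (if q then 0 else 1) = 1 := by
  split_ifs <;> simp

theorem sq_ite_sub_ite_le {𝒴 : Type*} [DecidableEq 𝒴] (a b y : 𝒴) :
    ((if a = y then 0 else 1 : ℝ) - (if b = y then 0 else 1)) ^ 2 ≤ if a = b then 0 else 1 := by
  split_ifs <;> simp_all

theorem integral_integral_tilted_le_of_moment {Θ Ω : Type*} [MeasurableSpace Θ]
    [MeasurableSpace Ω] (π : Measure Θ) [IsProbabilityMeasure π] (P : Measure Ω)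
    [IsProbabilityMeasure P] {u : Θ → Ω → ℝ} {Δ : Θ → ℝ} {A C d l l' K : ℝ}
    (hum : Measurable (Function.uncurry u)) (hub : ∀ θ ω, |u θ ω| ≤ A)
    (hΔm : Measurable Δ) (hΔb : ∀ θ, |Δ θ| ≤ C) (hΔ0 : ∀ θ, 0 ≤ Δ θ) (hd : 0 ≤ d) (hl : 0 < l)
    (hll' : l ≤ l') (humean : ∀ θ, ∫ ω, u θ ω ∂P = -(l * Δ θ))
    (hmoment : ∀ θ, ∫ ω, Real.exp (u θ ω) ∂P ≤ Real.exp (-(3 * l' / 4 * Δ θ) + l' * K / 4))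
    (hdim : ∀ γ : ℝ, 0 < γ → ∫ θ, Δ θ ∂(π.tilted fun θ => -(γ * Δ θ)) ≤ d / γ) :
    ∫ ω, ∫ θ, Δ θ ∂(π.tilted fun θ => u θ ω) ∂P ≤ K + 4 * (d * Real.log 2) / l := by
  have hl' : 0 < l' := hl.trans_le hll'
  have hmoment' : ∀ θ, ∫ ω, Real.exp (u θ ω + l' / 4 * Δ θ) ∂P
      ≤ Real.exp (l' * K / 4) * Real.exp (-(l' / 2 * Δ θ)) := fun θ => by
    simp_rw [Real.exp_add, integral_mul_const]
    refine (mul_le_mul_of_nonneg_right (hmoment θ) (Real.exp_pos _).le).trans_eq ?_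
    rw [← Real.exp_add, ← Real.exp_add]
    congr 1
    ring
  have hexpΔ : ∀ t : ℝ, Integrable (fun θ => Real.exp (-(t * Δ θ))) π := fun t =>
    integrable_exp_of_abs_le (C := |t| * C) (hΔm.const_mul t).neg fun θ => by
      rw [abs_neg, abs_mul]
      exact mul_le_mul_of_nonneg_left (hΔb θ) (abs_nonneg t)
  have hentropy := log_integral_exp_sub_le π hΔm hΔb hdim (half_pos hl')
    (half_le_self hl'.le)
  rw [div_div_cancel₀ hl'.ne'] at hentropy
  have hmain := integral_integral_tilted_le π P (h := fun θ => l' / 4 * Δ θ)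
    (B := l' / 4 * C) hum hub (hΔm.const_mul _) fun θ => by
      rw [abs_mul, abs_of_pos (by positivity : 0 < l' / 4)]
      exact mul_le_mul_of_nonneg_left (hΔb θ) (by positivity)
  simp_rw [humean, integral_const_mul] at hmain
  have hwm : Measurable (Function.uncurry fun θ ω => u θ ω + l' / 4 * Δ θ) :=
    hum.add ((hΔm.const_mul _).comp measurable_fst)
  have hwb : ∀ θ ω, |u θ ω + l' / 4 * Δ θ| ≤ A + l' / 4 * C := fun θ ω => by
    refine (abs_add_le _ _).trans (add_le_add (hub θ ω) ?_)
    rw [abs_mul, abs_of_pos (by positivity : 0 < l' / 4)]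
    exact mul_le_mul_of_nonneg_left (hΔb θ) (by positivity)
  have hwint : Integrable (Function.uncurry fun θ ω => Real.exp (u θ ω + l' / 4 * Δ θ))
      (π.prod P) := integrable_exp_of_abs_le hwm fun p => hwb p.1 p.2
  have hfirst : Real.log (∫ θ, ∫ ω, Real.exp (u θ ω + l' / 4 * Δ θ) ∂P ∂π)
      ≤ l' * K / 4 + Real.log (∫ θ, Real.exp (-(l' / 2 * Δ θ)) ∂π) := by
    have hpos : 0 < ∫ θ, ∫ ω, Real.exp (u θ ω + l' / 4 * Δ θ) ∂P ∂π := by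
      exact (integral_exp_pos hwint).trans_eq (integral_prod _ hwint)
    rw [← Real.log_exp (l' * K / 4), ← Real.log_mul (Real.exp_pos _).ne'
      (integral_exp_pos (hexpΔ _)).ne', ← integral_const_mul]
    exact Real.log_le_log hpos (integral_mono hwint.integral_prod_left
      ((hexpΔ _).const_mul _) hmoment')
  have hsecond : Real.log (∫ θ, Real.exp (-(l' * Δ θ)) ∂π)
      ≤ Real.log (∫ θ, Real.exp (-(l * Δ θ)) ∂π) := by
    refine Real.log_le_log (integral_exp_pos (hexpΔ _)) (integral_mono (hexpΔ _) (hexpΔ _)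
      fun θ => ?_)
    exact Real.exp_le_exp.2 (neg_le_neg (mul_le_mul_of_nonneg_right hll' (hΔ0 θ)))
  have hdlog : 0 ≤ 4 * (d * Real.log 2) := by positivity
  have hbound : ∫ ω, ∫ θ, Δ θ ∂(π.tilted fun θ => u θ ω) ∂P - K
      ≤ 4 * (d * Real.log 2) / l' := by
    rw [le_div_iff₀ hl']
    linarith
  linarith [div_le_div_of_nonneg_left hdlog hl hll']

set_option maxHeartbeats 1000000 in
theorem integral_integral_gibbs_empErr_le {𝒳 𝒴 Θ : Type*} [MeasurableSpace 𝒳]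
    [MeasurableSpace 𝒴] [Fintype 𝒴] [DecidableEq 𝒴] [MeasurableSingletonClass 𝒴]
    [MeasurableSpace Θ] {N : ℕ} (hN : 0 < N)
    (Ps : Fin N → Measure (𝒳 × 𝒴)) [∀ i, IsProbabilityMeasure (Ps i)]
    {f : Θ → 𝒳 → 𝒴} (hf : Measurable fun p : Θ × 𝒳 => f p.1 p.2)
    (π : Measure Θ) [IsProbabilityMeasure π] (θt : Θ) {l K d : ℝ} (hl : 0 < l) (hd : 0 ≤ d)
    (hinf : ∀ θ, expErr N (Measure.pi Ps) f θt ≤ expErr N (Measure.pi Ps) f θ)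
    (hmargin : ∀ θ, l / N * patDist N (Measure.pi Ps) f θ θt
      ≤ (expErr N (Measure.pi Ps) f θ - expErr N (Measure.pi Ps) f θt) / 2 + K / 2)
    (hdim : ∀ γ : ℝ, 0 < γ →
      (∫ θ, expErr N (Measure.pi Ps) f θ
          ∂(Gibbs π (fun θ' => -(γ * expErr N (Measure.pi Ps) f θ'))))
        - expErr N (Measure.pi Ps) f θt ≤ d / γ) :
    ∫ ω, (∫ θ, expErr N (Measure.pi Ps) f θ
        ∂(Gibbs π (fun θ' => -(l * empErr N f θ' ω)))) ∂(Measure.pi Ps)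
      ≤ expErr N (Measure.pi Ps) f θt + K + 4 * (d * Real.log 2) / l := by
  have hN' : (0 : ℝ) < N := Nat.cast_pos.2 hN
  let e : Θ → 𝒳 × 𝒴 → ℝ := fun θ z => if f θ z.1 = z.2 then 0 else 1
  let D : Θ → 𝒳 × 𝒴 → ℝ := fun θ z => if f θ z.1 = f θt z.1 then 0 else 1
  have hfθ : ∀ θ, Measurable (f θ) := fun θ => hf.comp measurable_prodMk_left
  have hset : MeasurableSet {p : Θ × (𝒳 × 𝒴) | f p.1 p.2.1 = p.2.2} :=
    measurableSet_eq_fun (hf.comp (measurable_fst.prodMk measurable_snd.fst)) measurable_snd.snd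
  have he : Measurable (Function.uncurry e) :=
    Measurable.ite hset measurable_const measurable_const
  have heθ : ∀ θ, Measurable (e θ) := fun θ => he.comp measurable_prodMk_left
  have hsetD : ∀ θ, MeasurableSet {z : 𝒳 × 𝒴 | f θ z.1 = f θt z.1} := fun θ =>
    measurableSet_eq_fun ((hfθ θ).comp measurable_fst) ((hfθ θt).comp measurable_fst)
  have hDm : ∀ θ, Measurable (D θ) := fun θ =>
    Measurable.ite (hsetD θ) measurable_const measurable_const
  have heb : ∀ θ z, |e θ z| ≤ 1 := fun θ z => by
    simp only [e]
    split_ifs <;> simp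
  have hDb : ∀ θ z, |D θ z| ≤ 1 := fun θ z => by
    simp only [D]
    split_ifs <;> simp
  have heint : ∀ θ i, Integrable (e θ) (Ps i) := fun θ i =>
    integrable_of_measurable_of_abs_le (heθ θ) (heb θ)
  set R : Θ → ℝ := expErr N (Measure.pi Ps) f
  set M : Θ → ℝ := fun θ => patDist N (Measure.pi Ps) f θ θt
  have hR : ∀ θ, R θ = (N : ℝ)⁻¹ * ∑ i, ∫ z, e θ z ∂(Ps i) := fun θ => by
    simp only [R, expErr, e]
    congr 1
    refine Finset.sum_congr rfl fun i _ => toReal_pi_setOf_eval Ps i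
      (p := fun z => f θ z.1 = z.2) (hset.preimage measurable_prodMk_left)
  have hM : ∀ θ, M θ = (N : ℝ)⁻¹ * ∑ i, ∫ z, D θ z ∂(Ps i) := fun θ => by
    simp only [M, patDist, D]
    congr 1
    refine Finset.sum_congr rfl fun i _ => toReal_pi_setOf_eval Ps i
      (p := fun z => f θ z.1 = f θt z.1) (hsetD θ)
  have hM0 : ∀ θ, 0 ≤ M θ := fun θ => by
    simp only [M, patDist]
    positivity
  have hRm : Measurable R := by
    simp_rw [funext hR]
    exact (Finset.measurable_sum _ fun i _ => (StronglyMeasurable.integral_prod_right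
      (f := e) he.stronglyMeasurable).measurable).const_mul _
  have hmean : ∀ g : Fin N → ℝ, (∀ i, |g i| ≤ 1) → |(N : ℝ)⁻¹ * ∑ i, g i| ≤ 1 := by
    intro g hg
    rw [abs_mul, abs_inv, Nat.abs_cast, inv_mul_le_one₀ hN']
    calc |∑ i, g i| ≤ ∑ i, |g i| := Finset.abs_sum_le_sum_abs _ _
      _ ≤ ∑ _ : Fin N, (1 : ℝ) := Finset.sum_le_sum fun i _ => hg i
      _ = N := by simp
  have hRb : ∀ θ, |R θ| ≤ 1 := fun θ => by
    rw [hR]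
    exact hmean _ fun i => abs_integral_le_of_abs_le (heb θ)
  have hrb : ∀ θ ω, |empErr N f θ ω| ≤ 1 := fun θ ω => hmean _ fun i => heb θ (ω i)
  have hrm : Measurable (Function.uncurry (empErr N f)) :=
    (Finset.measurable_sum _ fun i _ => he.comp (measurable_fst.prodMk
      ((measurable_pi_apply i).comp measurable_snd))).const_mul _
  have hrmean : ∀ θ, ∫ ω, empErr N f θ ω ∂(Measure.pi Ps) = R θ := fun θ => by
    have hi : ∀ i, Integrable (fun ω : Fin N → 𝒳 × 𝒴 => e θ (ω i)) (Measure.pi Ps) := fun i =>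
      integrable_of_measurable_of_abs_le ((heθ θ).comp (measurable_pi_apply i))
        fun ω => heb θ (ω i)
    calc ∫ ω, empErr N f θ ω ∂(Measure.pi Ps)
        = ∫ ω, (N : ℝ)⁻¹ * ∑ i, e θ (ω i) ∂(Measure.pi Ps) := rfl
      _ = R θ := by
        rw [integral_const_mul, integral_finsetSum _ fun i _ => hi i, hR]
        congr 1
        exact Finset.sum_congr rfl fun i _ =>
          integral_comp_eval (heθ θ).aestronglyMeasurable
  set a : ℝ := l / N
  have ha : 0 < a := div_pos hl hN'
  set l' : ℝ := N * Real.sinh a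
  have hll' : l ≤ l' := by
    have h := mul_le_mul_of_nonneg_left (Real.self_le_sinh_iff.2 ha.le) hN'.le
    rwa [mul_div_cancel₀ l hN'.ne'] at h
  have hl' : 0 < l' := hl.trans_le hll'
  let Δ : Θ → ℝ := fun θ => R θ - R θt
  have hΔm : Measurable Δ := hRm.sub_const _
  have hΔ0 : ∀ θ, 0 ≤ Δ θ := fun θ => sub_nonneg.2 (hinf θ)
  have hΔb : ∀ θ, |Δ θ| ≤ 2 := fun θ =>
    (abs_sub _ _).trans (by linarith [hRb θ, hRb θt])
  let u : Θ → (Fin N → 𝒳 × 𝒴) → ℝ := fun θ ω => -(l * (empErr N f θ ω - empErr N f θt ω))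
  have hum : Measurable (Function.uncurry u) :=
    ((hrm.sub ((hrm.comp measurable_prodMk_left).comp measurable_snd)).const_mul l).neg
  have hub : ∀ θ ω, |u θ ω| ≤ l * 2 := fun θ ω => by
    rw [abs_neg, abs_mul, abs_of_pos hl]
    exact mul_le_mul_of_nonneg_left
      ((abs_sub _ _).trans (by linarith [hrb θ ω, hrb θt ω])) hl.le
  have hrint : ∀ θ, Integrable (empErr N f θ) (Measure.pi Ps) := fun θ =>
    integrable_of_measurable_of_abs_le (hrm.comp measurable_prodMk_left) (hrb θ)
  have humean : ∀ θ, ∫ ω, u θ ω ∂(Measure.pi Ps) = -(l * Δ θ) := fun θ => by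
    simp only [u]
    rw [integral_neg, integral_const_mul, integral_sub (hrint θ) (hrint θt), hrmean, hrmean]
  have hmoment : ∀ θ, ∫ ω, Real.exp (u θ ω) ∂(Measure.pi Ps)
      ≤ Real.exp (-(l' * Δ θ) + N * (Real.cosh a - 1) * M θ) := fun θ => by
    have h := integral_exp_neg_sum_le Ps (W := fun z => e θ z - e θt z) (V := D θ)
      ((heθ θ).sub (heθ θt)) (hDm θ)
      (fun z => ite_sub_ite_mem _ _) (hDb θ) (fun z => sq_ite_sub_ite_le _ _ _) a
    simp_rw [integral_sub (heint θ _) (heint θt _), Finset.sum_sub_distrib] at h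
    have hu' : ∀ ω, u θ ω = -(a * (∑ i, e θ (ω i) - ∑ i, e θt (ω i))) := fun ω => by
      simp only [u, empErr, e, a]
      field_simp
    simp_rw [hu']
    refine h.trans_eq (congrArg Real.exp ?_)
    simp only [l', Δ, hR, hM]
    field_simp
  have hmoment' : ∀ θ, ∫ ω, Real.exp (u θ ω) ∂(Measure.pi Ps)
      ≤ Real.exp (-(3 * l' / 4 * Δ θ) + l' * K / 4) := fun θ => by
    refine (hmoment θ).trans (Real.exp_le_exp.2 ?_)
    have h1 := mul_le_mul_of_nonneg_left (cosh_sub_one_le ha.le)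
      (mul_nonneg hN'.le (hM0 θ))
    have h2 := mul_le_mul_of_nonneg_left (hmargin θ) (half_pos hl').le
    have h3 : N * M θ * (a / 2 * Real.sinh a) = l' / 2 * (a * M θ) := by
      simp only [l']
      ring
    rw [h3] at h1
    simp only [Δ]
    linarith
  have hgibbs : ∀ ω, Gibbs π (fun θ => -(l * empErr N f θ ω)) = π.tilted fun θ => u θ ω := by
    intro ω
    have hm : Measurable fun θ => -(l * empErr N f θ ω) :=
      ((hrm.comp measurable_prodMk_right).const_mul l).neg
    rw [gibbs_eq_tilted π hm (integrable_exp_of_abs_le (C := l * 1) hm fun θ => by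
      rw [abs_neg, abs_mul, abs_of_pos hl]
      exact mul_le_mul_of_nonneg_left (hrb θ ω) hl.le),
      ← tilted_add_const π _ (l * empErr N f θt ω)]
    congr 1
    ext θ
    simp only [u]
    ring
  have hexpΔ : ∀ t : ℝ, Integrable (fun θ => Real.exp (-(t * Δ θ))) π := fun t =>
    integrable_exp_of_abs_le (C := |t| * 2) (hΔm.const_mul t).neg fun θ => by
      rw [abs_neg, abs_mul]
      exact mul_le_mul_of_nonneg_left (hΔb θ) (abs_nonneg t)
  have hshift : ∀ ν : Measure Θ, IsProbabilityMeasure ν →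
      ∫ θ, Δ θ ∂ν = ∫ θ, R θ ∂ν - R θt := fun ν _ => by
    simp only [Δ]
    rw [integral_sub (integrable_of_measurable_of_abs_le hRm hRb) (integrable_const _)]
    simp
  have hdimΔ : ∀ γ : ℝ, 0 < γ → ∫ θ, Δ θ ∂(π.tilted fun θ => -(γ * Δ θ)) ≤ d / γ := by
    intro γ hγ
    rw [hshift _ (isProbabilityMeasure_tilted (hexpΔ γ))]
    have hm : Measurable fun θ => -(γ * R θ) := (hRm.const_mul γ).neg
    have hg : Gibbs π (fun θ => -(γ * R θ)) = π.tilted fun θ => -(γ * Δ θ) := by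
      rw [gibbs_eq_tilted π hm (integrable_exp_of_abs_le (C := γ * 1) hm fun θ => by
        rw [abs_neg, abs_mul, abs_of_pos hγ]
        exact mul_le_mul_of_nonneg_left (hRb θ) hγ.le), ← tilted_add_const π _ (γ * R θt)]
      congr 1
      ext θ
      simp only [Δ]
      ring
    rw [← hg]
    exact hdim γ hγ
  have huexp : ∀ ω, Integrable (fun θ => Real.exp (u θ ω)) π := fun ω =>
    integrable_exp_of_abs_le (g := fun θ => u θ ω) (hum.comp measurable_prodMk_right) (hub · ω)
  have hshift' : ∫ ω, ∫ θ, Δ θ ∂(π.tilted fun θ => u θ ω) ∂(Measure.pi Ps)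
      = ∫ ω, ∫ θ, R θ ∂(π.tilted fun θ => u θ ω) ∂(Measure.pi Ps) - R θt := by
    have h : ∀ ω, ∫ θ, Δ θ ∂(π.tilted fun θ => u θ ω)
        = ∫ θ, R θ ∂(π.tilted fun θ => u θ ω) - R θt := fun ω =>
      hshift _ (isProbabilityMeasure_tilted (huexp ω))
    simp_rw [h]
    rw [integral_sub (integrable_integral_tilted π _ hum hub hRm hRb) (integrable_const _)]
    simp
  have hmain := integral_integral_tilted_le_of_moment π (Measure.pi Ps) hum hub hΔm hΔb hΔ0 hd hl
    hll' humean hmoment' hdimΔ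
  rw [hshift'] at hmain
  simp_rw [hgibbs]
  linarith

/-- Adaptive rate under Mammen–Tsybakov margin and parametric complexity assumptions
(Corollary `cor1.1.23` of Catoni): under
(a) `R(θ) ≥ R(θ̃) + c D(θ,θ̃)^κ` for all `θ`, and
(b) `π_{exp(-γR)}(R) - inf R ≤ d/γ` for all `γ > 0`,
with `λ̄ = 2⁻¹ (8 log 2 · d)^{(κ-1)/(2κ-1)} (κc)^{1/(2κ-1)} N^{κ/(2κ-1)}`,
`P[π_{exp(-λ̄ r)}(R)] ≤ inf R + (2 - κ⁻¹)(κc)^{-1/(2κ-1)} (8 log 2 · d / N)^{κ/(2κ-1)}`. -/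
theorem statement_14 {𝒳 𝒴 Θ : Type*} [MeasurableSpace 𝒳] [MeasurableSpace 𝒴]
    [Fintype 𝒴] [DecidableEq 𝒴] [MeasurableSingletonClass 𝒴] [MeasurableSpace Θ]
    (N : ℕ) (hN : 0 < N)
    (Ps : Fin N → Measure (𝒳 × 𝒴)) [∀ i, IsProbabilityMeasure (Ps i)]
    (P : Measure (Fin N → 𝒳 × 𝒴)) [IsProbabilityMeasure P] (hP : P = Measure.pi Ps)
    (f : Θ → 𝒳 → 𝒴) (hf : Measurable fun p : Θ × 𝒳 => f p.1 p.2)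
    (π : Measure Θ) [IsProbabilityMeasure π]
    (θt : Θ) (c κ d : ℝ) (hc : 0 < c) (hκ : 1 ≤ κ) (hd : 0 < d)
    (hmargin : ∀ θ, expErr N P f θt + c * patDist N P f θ θt ^ κ ≤ expErr N P f θ)
    (hdim : ∀ γ : ℝ, 0 < γ →
      (∫ θ, expErr N P f θ ∂(Gibbs π (fun θ' => -(γ * expErr N P f θ'))))
          - (⨅ θ, expErr N P f θ)
        ≤ d / γ) :
    ∫ ω, (∫ θ, expErr N P f θ
        ∂(Gibbs π (fun θ' =>
          -((2⁻¹ * (8 * Real.log 2 * d) ^ ((κ - 1) / (2 * κ - 1))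
              * (κ * c) ^ (1 / (2 * κ - 1)) * (N : ℝ) ^ (κ / (2 * κ - 1)))
            * empErr N f θ' ω)))) ∂P
      ≤ (⨅ θ, expErr N P f θ)
        + (2 - κ⁻¹) * (κ * c) ^ (-(1 / (2 * κ - 1)))
          * (8 * Real.log 2 * d / N) ^ (κ / (2 * κ - 1)) := by
  subst hP
  have hκ0 : 0 < κ := by linarith
  have hN' : (0 : ℝ) < N := Nat.cast_pos.2 hN
  have hk : 0 < κ * c := mul_pos hκ0 hc
  have hL : 0 < 8 * Real.log 2 * d := by positivity
  have hinf : ∀ θ, expErr N (Measure.pi Ps) f θt ≤ expErr N (Measure.pi Ps) f θ := fun θ => by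
    have h : 0 ≤ c * patDist N (Measure.pi Ps) f θ θt ^ κ := by
      unfold patDist
      positivity
    linarith [hmargin θ]
  have hiInf : (⨅ θ, expErr N (Measure.pi Ps) f θ) = expErr N (Measure.pi Ps) f θt :=
    le_antisymm (ciInf_le ⟨_, Set.forall_mem_range.2 hinf⟩ θt)
      (have : Nonempty Θ := ⟨θt⟩; le_ciInf hinf)
  rw [hiInf] at hdim ⊢
  obtain ⟨h1, h2⟩ := rate_identities hL hk hN' hκ
  set l := 2⁻¹ * (8 * Real.log 2 * d) ^ ((κ - 1) / (2 * κ - 1))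
    * (κ * c) ^ (1 / (2 * κ - 1)) * (N : ℝ) ^ (κ / (2 * κ - 1))
  have hl : 0 < l := by positivity
  rw [mul_assoc (2 - κ⁻¹)]
  set B := (κ * c) ^ (-(1 / (2 * κ - 1))) * (8 * Real.log 2 * d / N) ^ (κ / (2 * κ - 1))
  have hB : 0 < B := by positivity
  have hmargin' : ∀ θ, l / N * patDist N (Measure.pi Ps) f θ θt
      ≤ (expErr N (Measure.pi Ps) f θ - expErr N (Measure.pi Ps) f θt) / 2
        + (1 - κ⁻¹) * B / 2 := fun θ => by
    refine mul_le_of_margin (D₀ := B * N / (2 * l)) hc hκ ?_ (by positivity) h2 ?_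
      (by linarith [hmargin θ])
    · unfold patDist
      positivity
    · field_simp
  refine (integral_integral_gibbs_empErr_le hN Ps hf π θt hl hd.le hinf hmargin'
    hdim).trans_eq ?_
  have h3 : 4 * (d * Real.log 2) / l = B := by
    rw [div_eq_iff hl.ne']
    linarith
  rw [h3]
  ring
end

section
/- Let N ≥ 1 and k ≥ 1 be integers and let σ : {1,…,N} × {0,…,k} → {0,1}. Let r̄ = (N(k+1))^{-1} ∑_{i=1}^N ∑_{j=0}^k σ(i,j), and for each choice function j = (j_1,…,j_N) ∈ {0,…,k}^N let r(j) = N^{-1} ∑_{i=1}^N σ(i, j_i). Then for every real constant λ, (k+1)^{-N} ∑_{j ∈ {0,…,k}^N} exp( λ ( Φ_{λ/N}(r̄) − r(j) ) ) ≤ 1. -/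
lemma exp_mul_Phi {a p : ℝ} (h : 0 < 1 - (1 - Real.exp (-a)) * p) :
    Real.exp (a * Phi a p) = (1 - (1 - Real.exp (-a)) * p)⁻¹ := by
  rcases eq_or_ne a 0 with rfl | ha
  · simp
  · rw [Phi, if_neg ha, ← mul_assoc, mul_neg, mul_inv_cancel₀ ha, neg_one_mul, Real.exp_neg,
      Real.exp_log h]

/-- The product of reals with arithmetic mean one is at most one. -/
lemma prod_le_one_of_sum_eq_card {ι : Type*} [Fintype ι] {x : ι → ℝ} (hx : ∀ i, 0 ≤ x i)
    (hsum : ∑ i, x i = Fintype.card ι) : ∏ i, x i ≤ 1 := by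
  calc ∏ i, x i ≤ ∏ i, Real.exp (x i - 1) :=
        Finset.prod_le_prod (fun i _ => hx i) fun i _ => by
          linarith [Real.add_one_le_exp (x i - 1)]
    _ = 1 := by simp [← Real.exp_sum, hsum]

lemma exp_neg_mul_of_eq_zero_or_one (a : ℝ) {s : ℝ} (hs : s = 0 ∨ s = 1) :
    Real.exp (-a * s) = 1 - (1 - Real.exp (-a)) * s := by
  rcases hs with rfl | rfl <;> simp

/-- For `σ : {1,…,N} × {0,…,k} → {0,1}`, with `r̄` the global average and
`r(j) = N⁻¹ ∑ᵢ σ(i, jᵢ)`, for every real `λ`,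
`(k+1)^{-N} ∑_j exp(λ (Φ_{λ/N}(r̄) - r(j))) ≤ 1`. -/
theorem statement_15 (N k : ℕ) (hN : 0 < N) (hk : 0 < k)
    (σ : Fin N → Fin (k + 1) → ℝ) (hσ : ∀ i j, σ i j = 0 ∨ σ i j = 1) (lam : ℝ) :
    ((k + 1 : ℝ) ^ N)⁻¹ *
        ∑ j : Fin N → Fin (k + 1),
          Real.exp (lam * (Phi (lam / N) (((N : ℝ) * (k + 1))⁻¹ * ∑ i, ∑ l, σ i l)
            - (N : ℝ)⁻¹ * ∑ i, σ i (j i)))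
      ≤ 1 := by
  have hN0 : (0 : ℝ) < N := by exact_mod_cast hN
  have hk0 : (0 : ℝ) < k + 1 := by positivity
  have : Nonempty (Fin N) := ⟨⟨0, hN⟩⟩
  set a := lam / N with ha
  have hlam : lam = N * a := by rw [ha]; field_simp
  set r := ((N : ℝ) * (k + 1))⁻¹ * ∑ i, ∑ l, σ i l with hr
  set D := 1 - (1 - Real.exp (-a)) * r with hD
  have hS : ∑ i, ∑ l, Real.exp (-a * σ i l) = N * (k + 1) * D := by
    simp_rw [exp_neg_mul_of_eq_zero_or_one a (hσ _ _), Finset.sum_sub_distrib, ← Finset.mul_sum]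
    simp only [Finset.sum_const, Finset.card_univ, Fintype.card_fin, nsmul_eq_mul, hD, hr]
    push_cast
    field_simp
  have hDpos : 0 < D := by
    have h : 0 < ∑ i, ∑ l, Real.exp (-a * σ i l) :=
      Finset.sum_pos (fun i _ => Finset.sum_pos (fun l _ => Real.exp_pos _)
        Finset.univ_nonempty) Finset.univ_nonempty
    rw [hS] at h
    exact pos_of_mul_pos_right h (by positivity)
  have hterm (j : Fin N → Fin (k + 1)) :
      Real.exp (lam * (Phi a r - (N : ℝ)⁻¹ * ∑ i, σ i (j i))) =
        (D ^ N)⁻¹ * ∏ i, Real.exp (-a * σ i (j i)) := by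
    have h : lam * (Phi a r - (N : ℝ)⁻¹ * ∑ i, σ i (j i)) =
        N * (a * Phi a r) + ∑ i, -a * σ i (j i) := by
      rw [hlam, ← Finset.mul_sum]
      field_simp
      ring
    rw [h, Real.exp_add, Real.exp_nat_mul, exp_mul_Phi hDpos, Real.exp_sum, inv_pow]
  have hprod : ∑ j : Fin N → Fin (k + 1), ∏ i, Real.exp (-a * σ i (j i)) =
      ∏ i, ∑ l, Real.exp (-a * σ i l) := by
    rw [Finset.prod_univ_sum, Fintype.piFinset_univ]
  calc _ = ∏ i, (∑ l, Real.exp (-a * σ i l)) / ((k + 1) * D) := by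
        simp_rw [hterm]
        rw [← Finset.mul_sum, hprod, Finset.prod_div_distrib, Finset.prod_const,
          Finset.card_univ, Fintype.card_fin, mul_pow]
        rw [div_eq_mul_inv, mul_inv]
        ring
    _ ≤ 1 := by
        refine prod_le_one_of_sum_eq_card (fun i => div_nonneg
          (Finset.sum_nonneg fun l _ => (Real.exp_pos _).le) (mul_pos hk0 hDpos).le) ?_
        rw [← Finset.sum_div, hS, Fintype.card_fin, mul_assoc]
        exact mul_div_cancel_right₀ _ (by positivity)
end

section
/- Let E be a finite-dimensional real inner product space, n ≥ 1, and let (x_i, y_i)_{i=1}^n be a finite labelled family with x_i ∈ E and y_i ∈ {−1,+1}, both labels occurring. Let A = { w ∈ E : min_{i : y_i = +1} ⟨w, x_i⟩ − max_{i : y_i = −1} ⟨w, x_i⟩ ≥ 2 }, let V = { u − v : u ∈ convexHull{x_i : y_i = +1}, v ∈ convexHull{x_i : y_i = −1} }, and let v* be the unique point of minimal norm of the compact convex set V. Then: (i) A ≠ ∅ if and only if v* ≠ 0; (ii) if v* ≠ 0, then w* = 2 v* / ‖v*‖² belongs to A, is the unique minimizer of ‖w‖ over A, and ‖w*‖ =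 2/‖v*‖; consequently the margin ‖w*‖^{-1} equals half the distance ‖v*‖ between the convex hulls of the positive and negative patterns. -/
open scoped RealInnerProductSpace

open scoped Pointwise in
/-- The set of differences of points of two convex hulls is the convex hull of the
Minkowski difference. -/
theorem setOf_sub_convexHull_eq {E : Type*} [AddCommGroup E] [Module ℝ E] (P N : Set E) :
    {z : E | ∃ u ∈ convexHull ℝ P, ∃ v ∈ convexHull ℝ N, z = u - v} =
      convexHull ℝ (P - N) := by
  rw [convexHull_sub]
  ext z
  simp only [Set.mem_ofPred_eq, Set.mem_sub, eq_comm]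

section

variable {E : Type*} [NormedAddCommGroup E] [InnerProductSpace ℝ E]

/-- Variational inequality for a point of minimal norm of a convex set. -/
theorem Convex.norm_sq_le_inner_of_forall_norm_le {V : Set E} (hV : Convex ℝ V) {v : E}
    (hv : v ∈ V) (hmin : ∀ z ∈ V, ‖v‖ ≤ ‖z‖) {z : E} (hz : z ∈ V) :
    ‖v‖ ^ 2 ≤ ⟪v, z⟫ := by
  have : Nonempty V := ⟨⟨v, hv⟩⟩
  have hinf : ‖(0 : E) - v‖ = ⨅ w : V, ‖(0 : E) - w‖ := by
    refine le_antisymm (le_ciInf fun w => ?_) (ciInf_le ⟨0, ?_⟩ (⟨v, hv⟩ : V))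
    · simpa using hmin w w.2
    · rintro _ ⟨w, rfl⟩
      exact norm_nonneg _
  have h := (norm_eq_iInf_iff_real_inner_le_zero hV hv).1 hinf z hz
  rw [zero_sub, inner_neg_left, inner_sub_right, real_inner_self_eq_norm_sq] at h
  linarith

/-- A linear lower bound on a set extends to its convex hull. -/
theorem le_inner_of_mem_convexHull {S : Set E} {w : E} {c : ℝ} (h : ∀ z ∈ S, c ≤ ⟪w, z⟫)
    {z : E} (hz : z ∈ convexHull ℝ S) : c ≤ ⟪w, z⟫ :=
  convexHull_min h (convex_halfSpace_ge (innerₛₗ ℝ w).isLinear c) hz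

theorem norm_div_norm_sq_smul_self {v : E} (hv : v ≠ 0) {c : ℝ} (hc : 0 ≤ c) :
    ‖(c / ‖v‖ ^ 2) • v‖ = c / ‖v‖ := by
  have : ‖v‖ ≠ 0 := norm_ne_zero_iff.2 hv
  rw [norm_smul, Real.norm_of_nonneg (by positivity)]
  field_simp

/-- Cauchy-Schwarz as a lower bound on the norm. -/
theorem div_norm_le_norm_of_le_inner {v w : E} (hv : v ≠ 0) {c : ℝ} (h : c ≤ ⟪w, v⟫) :
    c / ‖v‖ ≤ ‖w‖ :=
  (div_le_iff₀ (norm_pos_iff.2 hv)).2 (h.trans (real_inner_le_norm w v))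

/-- The equality case of `div_norm_le_norm_of_le_inner`. -/
theorem eq_div_norm_sq_smul_of_norm_eq {v w : E} (hv : v ≠ 0) {c : ℝ} (hc : 0 ≤ c)
    (h : c ≤ ⟪w, v⟫) (hw : ‖w‖ = c / ‖v‖) : w = (c / ‖v‖ ^ 2) • v := by
  have hv0 : ‖v‖ ≠ 0 := norm_ne_zero_iff.2 hv
  have hsq : ‖w - (c / ‖v‖ ^ 2) • v‖ ^ 2 ≤ 0 := by
    rw [norm_sub_sq_real, norm_div_norm_sq_smul_self hv hc, hw, real_inner_smul_right]
    have h1 := mul_le_mul_of_nonneg_left h (by positivity : 0 ≤ c / ‖v‖ ^ 2)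
    have h2 : (c / ‖v‖) ^ 2 = c / ‖v‖ ^ 2 * c := by ring
    linarith
  have h0 := pow_eq_zero_iff two_ne_zero |>.1 (le_antisymm hsq (sq_nonneg _))
  exact sub_eq_zero.1 (norm_eq_zero.1 h0)

end

/-- Canonical separating hyperplane: with
`A = {w : min_{y_i=+1}⟪w,x_i⟫ - max_{y_j=-1}⟪w,x_j⟫ ≥ 2}`,
`V` the Minkowski difference of the convex hulls of positive and negative patterns,
and `v*` the point of minimal norm of `V`:
(i) `A ≠ ∅ ↔ v* ≠ 0`; (ii) if `v* ≠ 0` then `w* = 2v*/‖v*‖²` belongs to `A`,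
is the unique minimizer of the norm over `A`, and `‖w*‖ = 2/‖v*‖`. -/
theorem statement_16 {E : Type*} [NormedAddCommGroup E] [InnerProductSpace ℝ E]
    [FiniteDimensional ℝ E] (n : ℕ) (hn : 0 < n)
    (x : Fin n → E) (y : Fin n → ℝ) (hy : ∀ i, y i = 1 ∨ y i = -1)
    (hpos : ∃ i, y i = 1) (hneg : ∃ i, y i = -1)
    (A : Set E)
    (hA : A = {w : E | ∀ i j, y i = 1 → y j = -1 → ⟪w, x j⟫ + 2 ≤ ⟪w, x i⟫})
    (V : Set E)
    (hV : V = {z : E | ∃ u ∈ convexHull ℝ (x '' {i | y i = 1}),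
        ∃ v ∈ convexHull ℝ (x '' {i | y i = -1}), z = u - v})
    (vs : E) (hvs : vs ∈ V) (hmin : ∀ z ∈ V, ‖vs‖ ≤ ‖z‖) :
    (A.Nonempty ↔ vs ≠ 0)
    ∧ (vs ≠ 0 →
        (2 / ‖vs‖ ^ 2) • vs ∈ A
        ∧ (∀ w ∈ A, ‖(2 / ‖vs‖ ^ 2) • vs‖ ≤ ‖w‖)
        ∧ (∀ w ∈ A, ‖w‖ = ‖(2 / ‖vs‖ ^ 2) • vs‖ → w = (2 / ‖vs‖ ^ 2) • vs)
        ∧ ‖(2 / ‖vs‖ ^ 2) • vs‖ = 2 / ‖vs‖) := by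
  have hVc := hV.trans (setOf_sub_convexHull_eq _ _)
  have hconv : Convex ℝ V := hVc ▸ convex_convexHull ℝ _
  have hAV : ∀ w ∈ A, 2 ≤ ⟪w, vs⟫ := by
    intro w hw
    rw [hA] at hw
    rw [hVc] at hvs
    refine le_inner_of_mem_convexHull ?_ hvs
    rintro _ ⟨_, ⟨i, hi, rfl⟩, _, ⟨j, hj, rfl⟩, rfl⟩
    have := hw i j hi hj
    simp only [inner_sub_right]
    linarith
  have hmem : vs ≠ 0 → (2 / ‖vs‖ ^ 2) • vs ∈ A := by
    intro h0
    have hpos : 0 < ‖vs‖ ^ 2 := by positivity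
    rw [hA]
    intro i j hi hj
    have hz : x i - x j ∈ V := by
      rw [hV]
      exact ⟨x i, subset_convexHull ℝ _ ⟨i, hi, rfl⟩, x j,
        subset_convexHull ℝ _ ⟨j, hj, rfl⟩, rfl⟩
    have h := mul_le_mul_of_nonneg_left
      (hconv.norm_sq_le_inner_of_forall_norm_le hvs hmin hz)
      (by positivity : 0 ≤ 2 / ‖vs‖ ^ 2)
    rw [div_mul_cancel₀ _ hpos.ne', inner_sub_right] at h
    rw [real_inner_smul_left, real_inner_smul_left]
    linarith
  refine ⟨⟨?_, fun h0 => ⟨_, hmem h0⟩⟩, fun h0 => ?_⟩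
  · rintro ⟨w, hw⟩ rfl
    have := hAV w hw
    rw [inner_zero_right] at this
    linarith
  · have hnorm := norm_div_norm_sq_smul_self h0 (zero_le_two (α := ℝ))
    rw [hnorm]
    exact ⟨hmem h0, fun w hw => div_norm_le_norm_of_le_inner h0 (hAV w hw),
      fun w hw => eq_div_norm_sq_smul_of_norm_eq h0 zero_le_two (hAV w hw), rfl⟩
end

section
/- Consider in ℝ^d the family of half-spaces { x : ⟨w,x⟩ ≥ b } with w ∈ ℝ^d and b ∈ ℝ. Then: (i) there exists a set A ⊆ ℝ^d of d+1 points such that for every subset B ⊆ A there exist w ∈ ℝ^d and b ∈ ℝ with B = { x ∈ A : ⟨w,x⟩ ≥ b }; (ii) for every set A ⊆ ℝ^d with exactly d+2 points there exists a subset B ⊆ A such that no w ∈ ℝ^d and b ∈ ℝ satisfy B = { x ∈ A : ⟨w,x⟩ ≥ b }. Hence the Vapnik–Cervonenkis dimension of the family of half-spaces of ℝ^d equals d+1. -/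
open scoped RealInnerProductSpace

/-- The origin and the standard basis vectors form a set of `d + 1` points shattered by
half-spaces. -/
lemma exists_card_eq_succ_shattered_by_halfSpaces (d : ℕ) :
    ∃ A : Finset (EuclideanSpace ℝ (Fin d)), A.card = d + 1 ∧
      ∀ B ⊆ A, ∃ (w : EuclideanSpace ℝ (Fin d)) (b : ℝ), ∀ x ∈ A, (x ∈ B ↔ b ≤ ⟪w, x⟫) := by
  classical
  let e : Fin d → EuclideanSpace ℝ (Fin d) := fun i ↦ EuclideanSpace.single i 1
  have he : Function.Injective e := (EuclideanSpace.orthonormal_single).linearIndependent.injective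
  have he0 : (0 : EuclideanSpace ℝ (Fin d)) ∉ Finset.univ.image e := by
    simp [e]
  refine ⟨insert 0 (Finset.univ.image e), ?_, fun B _ ↦ ?_⟩
  · rw [Finset.card_insert_of_notMem he0, Finset.card_image_of_injective _ he]
    simp
  refine ⟨WithLp.toLp 2 fun i ↦ if e i ∈ B then 1 else -1, if 0 ∈ B then 0 else 1, fun x hx ↦ ?_⟩
  rcases Finset.mem_insert.1 hx with rfl | hx
  · by_cases h : (0 : EuclideanSpace ℝ (Fin d)) ∈ B <;> simp [h]
  · obtain ⟨i, -, rfl⟩ := Finset.mem_image.1 hx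
    have hw : ⟪WithLp.toLp 2 fun i ↦ if e i ∈ B then (1 : ℝ) else -1, e i⟫ =
        if e i ∈ B then (1 : ℝ) else -1 := by
      simp [e, EuclideanSpace.inner_single_right]
    rw [hw]
    split_ifs <;> norm_num <;> assumption

/-- Any finite set of more than `finrank ℝ E + 1` points has a subset that is not cut out by a
half-space. -/
lemma exists_subset_not_cut_by_halfSpace {E : Type*} [NormedAddCommGroup E]
    [InnerProductSpace ℝ E] [FiniteDimensional ℝ E] (A : Finset E)
    (hA : Module.finrank ℝ E + 1 < A.card) :
    ∃ B ⊆ A, ∀ (w : E) (b : ℝ), ¬ ∀ x ∈ A, (x ∈ B ↔ b ≤ ⟪w, x⟫) := by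
  classical
  have hdep : ¬ AffineIndependent ℝ ((↑) : A → E) := fun h ↦ by
    have h₁ := h.card_le_finrank_succ
    have h₂ := Submodule.finrank_le (vectorSpan ℝ (Set.range ((↑) : A → E)))
    rw [Fintype.card_coe] at h₁
    omega
  obtain ⟨I, p, hp, hp'⟩ := Convex.radon_partition hdep
  have hmem (x : A) : (x : E) ∈ {x ∈ A | x ∈ Subtype.val '' I} ↔ x ∈ I := by simp
  refine ⟨{x ∈ A | x ∈ Subtype.val '' I}, Finset.filter_subset _ _, fun w b h ↦ ?_⟩
  have hlin : IsLinearMap ℝ fun x : E ↦ ⟪w, x⟫ := (innerₛₗ ℝ w).isLinear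
  have hge : b ≤ ⟪w, p⟫ := by
    refine convexHull_min ?_ (convex_halfSpace_ge hlin b) hp
    rintro _ ⟨x, hx, rfl⟩
    exact (h x x.2).1 ((hmem x).2 hx)
  have hlt : ⟪w, p⟫ < b := by
    refine convexHull_min ?_ (convex_halfSpace_lt hlin b) hp'
    rintro _ ⟨x, hx, rfl⟩
    exact not_le.1 fun hb ↦ hx ((hmem x).1 ((h x x.2).2 hb))
  exact hge.not_gt hlt

/-- The Vapnik–Cervonenkis dimension of the family of half-spaces
`{x : ⟪w,x⟫ ≥ b}` of `ℝ^d` is `d+1`: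
(i) some set of `d+1` points is shattered by half-spaces;
(ii) no set of `d+2` points is shattered by half-spaces. -/
theorem statement_17 (d : ℕ) :
    (∃ A : Finset (EuclideanSpace ℝ (Fin d)), A.card = d + 1 ∧
      ∀ B ⊆ A, ∃ (w : EuclideanSpace ℝ (Fin d)) (b : ℝ),
        ∀ x ∈ A, (x ∈ B ↔ b ≤ ⟪w, x⟫))
    ∧ (∀ A : Finset (EuclideanSpace ℝ (Fin d)), A.card = d + 2 →
      ∃ B ⊆ A, ∀ (w : EuclideanSpace ℝ (Fin d)) (b : ℝ),
        ¬ (∀ x ∈ A, (x ∈ B ↔ b ≤ ⟪w, x⟫))) := by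
  exact ⟨exists_card_eq_succ_shattered_by_halfSpaces d,
    fun A hA ↦ exists_subset_not_cut_by_halfSpace A (by simp [hA])⟩
end

section
/- Let E be a real inner product space, n ≥ 2, x_1,…,x_n ∈ E, b_1,…,b_n ∈ ℝ, and γ > 0. Assume that for every choice of labels (y_1,…,y_n) ∈ {−1,+1}^n there exist w ∈ E with ‖w‖ = 1 and b ∈ ℝ such that min_{1 ≤ i ≤ n} ( ⟨w, x_i⟩ − b − b_i ) y_i ≥ γ. Let Var(x_1,…,x_n) = n^{-1} ∑_{i=1}^n ‖ x_i − n^{-1} ∑_{j=1}^n x_j ‖². Then Var(x_1,…,x_n)/γ² ≥ n − 1 when n is even, and Var(x_1,…,x_n)/γ² ≥ (n−1)(n²−1)/n² when n is odd. -/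
open scoped RealInnerProductSpace

/-- Testing the margin condition against a zero-sum weight vector removes both the common
offset and (by symmetry under `c ↦ -c`) the individual offsets. -/
lemma margin_mul_sum_abs_le_norm_sum_smul {ι E : Type*} [Fintype ι] [NormedAddCommGroup E]
    [InnerProductSpace ℝ E] {x : ι → E} {b : ι → ℝ} {γ : ℝ}
    (hsep : ∀ y : ι → ℝ, (∀ i, y i = 1 ∨ y i = -1) →
      ∃ (w : E) (b0 : ℝ), ‖w‖ = 1 ∧ ∀ i, γ ≤ (⟪w, x i⟫ - b0 - b i) * y i)
    {c : ι → ℝ} (hc : ∑ i, c i = 0) :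
    γ * ∑ i, |c i| ≤ ‖∑ i, c i • x i‖ := by
  have key : ∀ c : ι → ℝ, ∑ i, c i = 0 →
      γ * ∑ i, |c i| ≤ ‖∑ i, c i • x i‖ - ∑ i, c i * b i := by
    intro c hc
    obtain ⟨w, b0, hw, h⟩ := hsep (fun i => if 0 ≤ c i then 1 else -1)
      (fun i => by by_cases hi : 0 ≤ c i <;> simp [hi])
    have hterm : ∀ i, γ * |c i| ≤ (⟪w, x i⟫ - b0 - b i) * c i := by
      intro i
      have hi := mul_le_mul_of_nonneg_right (h i) (abs_nonneg (c i))
      refine hi.trans_eq ?_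
      by_cases h0 : 0 ≤ c i
      · simp [h0, abs_of_nonneg h0]
      · rw [if_neg h0, abs_of_neg (not_le.mp h0)]
        ring
    have hinner : ⟪w, ∑ i, c i • x i⟫ ≤ ‖∑ i, c i • x i‖ := by
      simpa [hw] using real_inner_le_norm w (∑ i, c i • x i)
    calc γ * ∑ i, |c i| ≤ ∑ i, (⟪w, x i⟫ - b0 - b i) * c i := by
          rw [Finset.mul_sum]
          exact Finset.sum_le_sum fun i _ => hterm i
      _ = ⟪w, ∑ i, c i • x i⟫ - b0 * ∑ i, c i - ∑ i, c i * b i := by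
          rw [inner_sum, Finset.mul_sum, ← Finset.sum_sub_distrib, ← Finset.sum_sub_distrib]
          refine Finset.sum_congr rfl fun i _ => ?_
          rw [real_inner_smul_right]
          ring
      _ ≤ _ := by rw [hc]; linarith
  have h₁ := key c hc
  have h₂ := key (fun i => -c i) (by simp [hc])
  simp only [abs_neg, neg_smul, neg_mul, Finset.sum_neg_distrib, norm_neg] at h₂
  linarith

/-- Second moments of a zero-sum vector whose coordinates are permuted at random. -/
lemma sum_perm_mul_eq {ι : Type*} [Fintype ι] [DecidableEq ι] {c : ι → ℝ}
    (hc : ∑ i, c i = 0) (i j : ι) :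
    Fintype.card ι * ((Fintype.card ι : ℝ) - 1) * ∑ σ : Equiv.Perm ι, c (σ i) * c (σ j) =
      Fintype.card (Equiv.Perm ι) * (∑ k, c k ^ 2) *
        (if i = j then (Fintype.card ι : ℝ) - 1 else -1) := by
  set D : ι → ι → ℝ := fun i j => ∑ σ : Equiv.Perm ι, c (σ i) * c (σ j) with hD
  have hinv : ∀ (τ : Equiv.Perm ι) (i j : ι), D (τ i) (τ j) = D i j := fun τ i j =>
    Fintype.sum_equiv (Equiv.mulRight τ) _ _ fun σ => by simp
  have hdiag : ∀ i, Fintype.card ι * D i i = Fintype.card (Equiv.Perm ι) * ∑ k, c k ^ 2 := by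
    intro i
    have h₁ : ∀ k, D k k = D i i := fun k => by
      simpa using hinv (Equiv.swap i k) i i
    have h₂ : ∑ k, D k k = Fintype.card ι * D i i := by
      simp [h₁]
    rw [← h₂, hD, Finset.sum_comm]
    have h₃ : ∀ σ : Equiv.Perm ι, ∑ k, c (σ k) * c (σ k) = ∑ k, c k ^ 2 := fun σ => by
      rw [← Equiv.sum_comp σ (fun k => c k ^ 2)]
      exact Finset.sum_congr rfl fun k _ => (sq _).symm
    simp [h₃]
  change _ * D i j = _
  by_cases hij : i = j
  · subst hij
    rw [if_pos rfl, ← hdiag i]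
    ring
  · have hoff : ∀ k ∈ Finset.univ.erase i, D i k = D i j := by
      intro k hk
      have hki : i ≠ k := (Finset.ne_of_mem_erase hk).symm
      have := hinv (Equiv.swap j k) i j
      rwa [Equiv.swap_apply_of_ne_of_ne hij hki, Equiv.swap_apply_left] at this
    have hrow : ∑ k, D i k = 0 := by
      rw [hD, Finset.sum_comm]
      refine Finset.sum_eq_zero fun σ _ => ?_
      rw [← Finset.mul_sum, Equiv.sum_comp σ c, hc, mul_zero]
    rw [← Finset.add_sum_erase _ _ (Finset.mem_univ i), Finset.sum_congr rfl hoff,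
      Finset.sum_const, Finset.card_erase_of_mem (Finset.mem_univ i), Finset.card_univ,
      nsmul_eq_mul, Nat.cast_sub (Fintype.card_pos_iff.mpr ⟨i⟩), Nat.cast_one] at hrow
    rw [if_neg hij, ← hdiag i]
    linear_combination (Fintype.card ι : ℝ) * hrow

/-- Averaging `‖∑ c (σ i) • z i‖ ^ 2` over all permutations `σ`, for zero-sum `c` and `z`. -/
lemma sum_perm_norm_sum_smul_sq {ι E : Type*} [Fintype ι] [DecidableEq ι]
    [NormedAddCommGroup E] [InnerProductSpace ℝ E] {c : ι → ℝ} (hc : ∑ i, c i = 0)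
    {z : ι → E} (hz : ∑ i, z i = 0) :
    Fintype.card ι * ((Fintype.card ι : ℝ) - 1) *
        ∑ σ : Equiv.Perm ι, ‖∑ i, c (σ i) • z i‖ ^ 2 =
      Fintype.card (Equiv.Perm ι) * (∑ k, c k ^ 2) * (Fintype.card ι * ∑ i, ‖z i‖ ^ 2) := by
  have hexp : ∑ σ : Equiv.Perm ι, ‖∑ i, c (σ i) • z i‖ ^ 2 =
      ∑ i, ∑ j, (∑ σ : Equiv.Perm ι, c (σ i) * c (σ j)) * ⟪z i, z j⟫ := by
    simp_rw [← real_inner_self_eq_norm_sq, sum_inner, inner_sum, real_inner_smul_left,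
      real_inner_smul_right, Finset.sum_mul]
    rw [Finset.sum_comm]
    refine Finset.sum_congr rfl fun i _ => ?_
    rw [Finset.sum_comm]
    simp only [mul_assoc]
  have hrow : ∀ i, ∑ j, (if i = j then (Fintype.card ι : ℝ) - 1 else -1) * ⟪z i, z j⟫ =
      Fintype.card ι * ‖z i‖ ^ 2 := by
    intro i
    have h : ∀ j, (if i = j then (Fintype.card ι : ℝ) - 1 else -1) * ⟪z i, z j⟫ =
        (if i = j then (Fintype.card ι : ℝ) * ⟪z i, z j⟫ else 0) - ⟪z i, z j⟫ := by
      intro j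
      split_ifs <;> ring
    simp_rw [h]
    rw [Finset.sum_sub_distrib, ← inner_sum, hz, inner_zero_right, sub_zero,
      Finset.sum_ite_eq, if_pos (Finset.mem_univ i), real_inner_self_eq_norm_sq]
  rw [hexp]
  simp_rw [Finset.mul_sum, ← mul_assoc, sum_perm_mul_eq hc]
  simp_rw [mul_assoc, ← Finset.mul_sum, hrow, ← Finset.mul_sum]
  ring

/-- Every zero-sum weight vector gives a lower bound for the scatter of a family shattered
with margin `γ`. -/
lemma margin_sq_mul_sum_abs_sq_le {ι E : Type*} [Fintype ι] [Nonempty ι]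
    [NormedAddCommGroup E] [InnerProductSpace ℝ E] {x : ι → E} {b : ι → ℝ} {γ : ℝ}
    (hγ : 0 < γ)
    (hsep : ∀ y : ι → ℝ, (∀ i, y i = 1 ∨ y i = -1) →
      ∃ (w : E) (b0 : ℝ), ‖w‖ = 1 ∧ ∀ i, γ ≤ (⟪w, x i⟫ - b0 - b i) * y i)
    {c : ι → ℝ} (hc : ∑ i, c i = 0) :
    ((Fintype.card ι : ℝ) - 1) * (γ * ∑ i, |c i|) ^ 2 ≤
      (∑ i, c i ^ 2) * ∑ i, ‖x i - (Fintype.card ι : ℝ)⁻¹ • ∑ j, x j‖ ^ 2 := by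
  classical
  set μ : E := (Fintype.card ι : ℝ)⁻¹ • ∑ j, x j with hμ
  have hcard : (1 : ℝ) ≤ Fintype.card ι := by exact_mod_cast Fintype.card_pos
  have hcard0 : (Fintype.card ι : ℝ) ≠ 0 := by positivity
  have hperm : (0 : ℝ) < Fintype.card (Equiv.Perm ι) := by exact_mod_cast Fintype.card_pos
  have hz : ∑ i, (x i - μ) = 0 := by
    rw [Finset.sum_sub_distrib, Finset.sum_const, Finset.card_univ, ← Nat.cast_smul_eq_nsmul ℝ,
      hμ, smul_inv_smul₀ hcard0, sub_self]
  have hbound : ∀ σ : Equiv.Perm ι,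
      (γ * ∑ i, |c i|) ^ 2 ≤ ‖∑ i, c (σ i) • (x i - μ)‖ ^ 2 := by
    intro σ
    have hcσ : ∑ i, c (σ i) = 0 := by rw [Equiv.sum_comp σ c, hc]
    have h := margin_mul_sum_abs_le_norm_sum_smul hsep hcσ
    rw [Equiv.sum_comp σ (fun i => |c i|)] at h
    have hshift : ∑ i, c (σ i) • (x i - μ) = ∑ i, c (σ i) • x i := by
      simp_rw [smul_sub]
      rw [Finset.sum_sub_distrib, ← Finset.sum_smul, hcσ, zero_smul, sub_zero]
    rw [hshift]
    exact pow_le_pow_left₀ (by positivity) h 2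
  have hsum := Finset.sum_le_sum fun σ (_ : σ ∈ Finset.univ) => hbound σ
  rw [Finset.sum_const, Finset.card_univ, nsmul_eq_mul] at hsum
  have hmul := mul_le_mul_of_nonneg_left hsum
    (mul_nonneg (zero_le_one.trans hcard) (sub_nonneg.mpr hcard))
  rw [sum_perm_norm_sum_smul_sq hc hz] at hmul
  refine le_of_mul_le_mul_left ?_ (mul_pos (zero_lt_one.trans_le hcard) hperm)
  linarith

lemma sum_ite_val_lt (p q : ℕ) (u v : ℝ) :
    ∑ i : Fin (p + q), (if i.val < p then u else v) = p * u + q * v := by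
  simp [Fin.sum_univ_add]

/-- Variance lower bound for families of points shattered with margin `γ` by affine
functions with unit-norm direction: if for every labelling `y ∈ {-1,+1}^n` there are
`w`, `‖w‖ = 1`, and `b₀` with `(⟪w,x_i⟫ - b₀ - b_i) y_i ≥ γ` for all `i`, then
`Var(x_1,…,x_n)/γ² ≥ n-1` for even `n` and `≥ (n-1)(n²-1)/n²` for odd `n`. -/
theorem statement_18 {E : Type*} [NormedAddCommGroup E] [InnerProductSpace ℝ E]
    (n : ℕ) (hn : 2 ≤ n) (x : Fin n → E) (b : Fin n → ℝ) (γ : ℝ) (hγ : 0 < γ)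
    (hsep : ∀ y : Fin n → ℝ, (∀ i, y i = 1 ∨ y i = -1) →
      ∃ (w : E) (b0 : ℝ), ‖w‖ = 1 ∧ ∀ i, γ ≤ (⟪w, x i⟫ - b0 - b i) * y i) :
    (Even n →
      (n - 1 : ℝ) ≤ ((n : ℝ)⁻¹ * ∑ i, ‖x i - (n : ℝ)⁻¹ • ∑ j, x j‖ ^ 2) / γ ^ 2)
    ∧ (Odd n →
      ((n : ℝ) - 1) * ((n : ℝ) ^ 2 - 1) / (n : ℝ) ^ 2
        ≤ ((n : ℝ)⁻¹ * ∑ i, ‖x i - (n : ℝ)⁻¹ • ∑ j, x j‖ ^ 2) / γ ^ 2) := by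
  have : NeZero n := ⟨by omega⟩
  have hn' : (2 : ℝ) ≤ n := by exact_mod_cast hn
  have key : ∀ c : Fin n → ℝ, ∑ i, c i = 0 → ((n : ℝ) - 1) * (γ * ∑ i, |c i|) ^ 2 ≤
      (∑ i, c i ^ 2) * ∑ i, ‖x i - (n : ℝ)⁻¹ • ∑ j, x j‖ ^ 2 := by
    intro c hc
    simpa only [Fintype.card_fin] using margin_sq_mul_sum_abs_sq_le hγ hsep hc
  generalize ∑ i, ‖x i - (n : ℝ)⁻¹ • ∑ j, x j‖ ^ 2 = V at key ⊢
  have hn0 : (0 : ℝ) < n := by linarith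
  constructor
  · rintro ⟨m, rfl⟩
    have h := key (fun i => if i.val < m then 1 else -1) (by rw [sum_ite_val_lt]; ring)
    simp only [apply_ite abs, ite_pow, sum_ite_val_lt] at h
    rw [le_div_iff₀ (by positivity), inv_mul_eq_div, le_div_iff₀ hn0]
    refine le_of_mul_le_mul_left ?_ hn0
    push_cast at h ⊢
    norm_num at h
    linarith
  · rintro ⟨m, rfl⟩
    have hm : (0 : ℝ) < m := by
      have : 0 < m := by omega
      exact_mod_cast this
    have hsplit : 2 * m + 1 = m + (m + 1) := by ring
    have hsum : ∀ u v : ℝ, ∑ i : Fin (2 * m + 1), (if i.val < m then u else v) =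
        m * u + (m + 1 : ℕ) * v := by
      rw [hsplit]
      exact sum_ite_val_lt m (m + 1)
    have h := key (fun i => if i.val < m then (m : ℝ) + 1 else -m)
      (by rw [hsum]; push_cast; ring)
    simp only [apply_ite abs, ite_pow, hsum, abs_neg, abs_of_pos hm,
      abs_of_pos (show (0 : ℝ) < (m : ℝ) + 1 by linarith)] at h
    rw [le_div_iff₀ (by positivity), inv_mul_eq_div, le_div_iff₀ hn0, div_mul_eq_mul_div,
      div_mul_eq_mul_div, div_le_iff₀ (by positivity)]
    refine le_of_mul_le_mul_left ?_ (show (0 : ℝ) < m * (m + 1) by positivity)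
    push_cast at h ⊢
    have h' := mul_le_mul_of_nonneg_left h (show (0 : ℝ) ≤ 2 * m + 1 by positivity)
    linarith
end

section
/- Let x_1,…,x_N be pairwise distinct points of ℝ^d. Then the functions g_i : ℝ^d → ℝ defined by g_i(x) = exp( −‖x − x_i‖² ), i = 1,…,N, are linearly independent: if λ_1,…,λ_N ∈ ℝ satisfy ∑_{i=1}^N λ_i exp( −‖x − x_i‖² ) = 0 for every x ∈ ℝ^d, then λ_1 = … = λ_N = 0. -/
/-- The character `v ↦ exp(2⟪a, v⟫)` of the additive group of a real inner product space. -/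
noncomputable def expInnerHom {E : Type*} [NormedAddCommGroup E] [InnerProductSpace ℝ E] (a : E) :
    Multiplicative E →* ℝ where
  toFun v := Real.exp (2 * inner ℝ a v.toAdd)
  map_one' := by simp
  map_mul' v w := by rw [toAdd_mul, inner_add_right, mul_add, Real.exp_add]

theorem expInnerHom_injective {E : Type*} [NormedAddCommGroup E] [InnerProductSpace ℝ E] :
    Function.Injective (expInnerHom : E → Multiplicative E →* ℝ) := by
  intro a b h
  refine ext_inner_right ℝ fun v => ?_
  have hv : Real.exp (2 * inner ℝ a v) = Real.exp (2 * inner ℝ b v) :=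
    DFunLike.congr_fun h (Multiplicative.ofAdd v)
  have := Real.exp_injective hv
  linarith

theorem exp_neg_norm_sub_sq {E : Type*} [NormedAddCommGroup E] [InnerProductSpace ℝ E] (v a : E) :
    Real.exp (-‖v - a‖ ^ 2) =
      Real.exp (-‖v‖ ^ 2) * (Real.exp (-‖a‖ ^ 2) * Real.exp (2 * inner ℝ a v)) := by
  rw [← Real.exp_add, ← Real.exp_add, norm_sub_sq_real, real_inner_comm]
  ring_nf

/-- The Gaussian functions `x ↦ exp(-‖x - x_i‖²)` attached to pairwise distinct points
`x_1, …, x_N` of `ℝ^d` are linearly independent. -/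
theorem statement_19 (d N : ℕ) (x : Fin N → EuclideanSpace ℝ (Fin d))
    (hx : Function.Injective x) (lam : Fin N → ℝ)
    (hzero : ∀ v : EuclideanSpace ℝ (Fin d),
      ∑ i, lam i * Real.exp (-‖v - x i‖ ^ 2) = 0) :
    ∀ i, lam i = 0 := by
  have hli := (linearIndependent_monoidHom (Multiplicative (EuclideanSpace ℝ (Fin d))) ℝ).comp
    (fun i => expInnerHom (x i)) (expInnerHom_injective.comp hx)
  rw [Fintype.linearIndependent_iff] at hli
  have key := hli (fun i => lam i * Real.exp (-‖x i‖ ^ 2)) <| by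
    funext w
    have hw : Real.exp (-‖w.toAdd‖ ^ 2) *
        ∑ i, lam i * Real.exp (-‖x i‖ ^ 2) * Real.exp (2 * inner ℝ (x i) w.toAdd) = 0 := by
      rw [← hzero w.toAdd, Finset.mul_sum]
      refine Finset.sum_congr rfl fun i _ => ?_
      rw [exp_neg_norm_sub_sq]
      ring
    rw [Finset.sum_apply]
    exact (mul_eq_zero.mp hw).resolve_left (Real.exp_ne_zero _)
  exact fun i => (mul_eq_zero.mp (key i)).resolve_right (Real.exp_ne_zero _)
end
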